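/- Let the state sequence S = (S_1,…,S_N) be a random element of S^N, independent of the codebook, and suppose that conditionally on S = s and C_0 = x the output Y is distributed as ∏_{n=1}^N P(y_n|x_n,s_n). Let u ⊆ S^N be a set of state sequences all having the same empirical distribution (i.e., for every state σ ∈ S and all s, s′ ∈ u, #{n : s_n = σ} = #{n : s′_n = σ}), with Pr(S ∈ u) > 0. Then for every ρ ∈ [0,1], every s* ∈ u, and M − 1 ≤ e^{NR}, the conditional probability of maximum-likelihood decoding failure given S ∈ u satisfies P_{e|u} ≤ exp(−N(E_{0,N}(ρ,Q,s*) − ρR)). -/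

import Mathlib

open scoped Classical
open Finset

theorem sum_pi_prod_eq_one {A : Type*} [Fintype A] (q : A → ℝ) (hq1 : ∑ a, q a = 1) (m : ℕ) :
    ∑ c : Fin m → A, ∏ i, q (c i) = 1 := by
  rw [← Fintype.prod_sum (fun (_ : Fin m) a => q a)]
  simp [hq1]

theorem sum_pi_prod_mul_apply {A : Type*} [Fintype A] (q f : A → ℝ) (hq1 : ∑ a, q a = 1)
    {m : ℕ} (i : Fin m) :
    ∑ c : Fin m → A, (∏ j, q (c j)) * f (c i) = ∑ a, q a * f a := by
  have h (c : Fin m → A) : (∏ j, q (c j)) * f (c i)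
      = ∏ j, q (c j) * (if j = i then f (c j) else 1) := by
    rw [Finset.prod_mul_distrib, Finset.prod_ite_eq' Finset.univ i (fun j => f (c j))]
    simp
  simp_rw [h]
  rw [← Fintype.prod_sum (fun (j : Fin m) a => q a * (if j = i then f a else 1)),
    Finset.prod_eq_single i]
  · simp
  · intro j _ hj
    simp [hj, hq1]
  · simp

theorem sum_pi_prod_mul_rpow_sum_le {A : Type*} [Fintype A] (q f : A → ℝ)
    (hq0 : ∀ a, 0 ≤ q a) (hq1 : ∑ a, q a = 1) (hf : ∀ a, 0 ≤ f a) (m : ℕ)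
    {ρ : ℝ} (hρ0 : 0 ≤ ρ) (hρ1 : ρ ≤ 1) :
    ∑ c : Fin m → A, (∏ i, q (c i)) * (∑ i, f (c i)) ^ ρ
      ≤ (m : ℝ) ^ ρ * (∑ a, q a * f a) ^ ρ := by
  have hj := (Real.concaveOn_rpow hρ0 hρ1).le_map_sum (t := Finset.univ)
    (w := fun c : Fin m → A => ∏ i, q (c i)) (p := fun c => ∑ i, f (c i))
    (fun c _ => Finset.prod_nonneg fun i _ => hq0 _) (sum_pi_prod_eq_one q hq1 m)
    (fun c _ => Set.mem_Ici.2 (Finset.sum_nonneg fun i _ => hf _))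
  simp only [smul_eq_mul] at hj
  refine hj.trans (le_of_eq ?_)
  rw [← Real.mul_rpow (Nat.cast_nonneg m)
    (Finset.sum_nonneg fun a _ => mul_nonneg (hq0 a) (hf a))]
  congr 1
  simp_rw [Finset.mul_sum]
  rw [Finset.sum_comm]
  simp_rw [sum_pi_prod_mul_apply q f hq1]
  simp [Finset.mul_sum]

theorem mul_ite_le_rpow_mul_rpow_sum {m : ℕ} {w : ℝ} (hw : 0 ≤ w) (v : Fin m → ℝ)
    (hv : ∀ i, 0 ≤ v i) {ρ : ℝ} (hρ0 : 0 ≤ ρ) :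
    w * (if ∃ i, w ≤ v i then 1 else 0)
      ≤ w ^ (1 / (1 + ρ)) * (∑ i, v i ^ (1 / (1 + ρ))) ^ ρ := by
  have h_nonneg : 0 ≤ ∑ i, v i ^ (1 / (1 + ρ)) :=
    Finset.sum_nonneg fun i _ => Real.rpow_nonneg (hv i) _
  split_ifs with h
  · obtain ⟨i, hi⟩ := h
    have hle : w ^ (1 / (1 + ρ)) ≤ ∑ i, v i ^ (1 / (1 + ρ)) :=
      (Real.rpow_le_rpow hw hi (by positivity)).trans
        (Finset.single_le_sum (f := fun i => v i ^ (1 / (1 + ρ)))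
          (fun j _ => Real.rpow_nonneg (hv j) _) (Finset.mem_univ i))
    calc w * 1 = (w ^ (1 / (1 + ρ))) ^ (1 + ρ) := by
          rw [← Real.rpow_mul hw, one_div_mul_cancel (by positivity), Real.rpow_one, mul_one]
      _ = w ^ (1 / (1 + ρ)) * (w ^ (1 / (1 + ρ))) ^ ρ := by
          rw [Real.rpow_add' (Real.rpow_nonneg hw _) (by positivity), Real.rpow_one]
      _ ≤ _ := by gcongr
  · rw [mul_zero]
    positivity

/-- Gallager's random coding bound for a finite channel. -/
theorem random_coding_bound {A B : Type*} [Fintype A] [Fintype B] (q : A → ℝ)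
    (hq0 : ∀ a, 0 ≤ q a) (hq1 : ∑ a, q a = 1) (W : B → A → ℝ) (hW : ∀ b a, 0 ≤ W b a)
    (m : ℕ) {ρ : ℝ} (hρ0 : 0 ≤ ρ) (hρ1 : ρ ≤ 1) :
    ∑ c : Fin (m + 1) → A, ∑ b, (∏ i, q (c i)) * W b (c 0) *
        (if ∃ i, i ≠ 0 ∧ W b (c 0) ≤ W b (c i) then 1 else 0)
      ≤ (m : ℝ) ^ ρ * ∑ b, (∑ a, q a * W b a ^ (1 / (1 + ρ))) ^ (1 + ρ) := by
  rw [Finset.sum_comm, Finset.mul_sum]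
  refine Finset.sum_le_sum fun b _ => ?_
  set f : A → ℝ := fun a => W b a ^ (1 / (1 + ρ)) with hf
  have hf0 : ∀ a, 0 ≤ f a := fun a => Real.rpow_nonneg (hW b a) _
  have hF : 0 ≤ ∑ a, q a * f a := Finset.sum_nonneg fun a _ => mul_nonneg (hq0 a) (hf0 a)
  calc _ = ∑ a, ∑ c : Fin m → A, q a * (∏ i, q (c i)) *
          (W b a * (if ∃ i, W b a ≤ W b (c i) then 1 else 0)) := by
        rw [← (Fin.consEquiv fun _ => A).sum_comp, Fintype.sum_prod_type]
        simp [Fin.consEquiv, Fin.prod_univ_succ, Fin.exists_fin_succ, mul_assoc]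
    _ ≤ ∑ a, ∑ c : Fin m → A, q a * (∏ i, q (c i)) * (f a * (∑ i, f (c i)) ^ ρ) := by
        refine Finset.sum_le_sum fun a _ => Finset.sum_le_sum fun c _ => ?_
        refine mul_le_mul_of_nonneg_left ?_
          (mul_nonneg (hq0 a) (Finset.prod_nonneg fun i _ => hq0 _))
        exact mul_ite_le_rpow_mul_rpow_sum (hW b a) (fun i => W b (c i)) (fun i => hW _ _) hρ0
    _ = (∑ a, q a * f a) * ∑ c : Fin m → A, (∏ i, q (c i)) * (∑ i, f (c i)) ^ ρ := by
        rw [Finset.sum_mul_sum]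
        exact Finset.sum_congr rfl fun a _ => Finset.sum_congr rfl fun c _ => by ring
    _ ≤ (∑ a, q a * f a) * ((m : ℝ) ^ ρ * (∑ a, q a * f a) ^ ρ) :=
        mul_le_mul_of_nonneg_left
          (sum_pi_prod_mul_rpow_sum_le q f hq0 hq1 hf0 m hρ0 hρ1) hF
    _ = _ := by
        rw [Real.rpow_add' hF (by positivity), Real.rpow_one]
        ring

/-- Single-letterization of the Gallager function for product inputs and channels. -/
theorem sum_rpow_sum_prod_eq_prod {X Y : Type*} [Fintype X] [Fintype Y] {N : ℕ}
    (Q : X → ℝ) (hQ0 : ∀ x, 0 ≤ Q x) (P : Fin N → Y → X → ℝ) (hP0 : ∀ n y x, 0 ≤ P n y x)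
    (r t : ℝ) :
    ∑ y : Fin N → Y, (∑ x : Fin N → X, (∏ n, Q (x n)) * (∏ n, P n (y n) (x n)) ^ r) ^ t
      = ∏ n, ∑ y, (∑ x, Q x * P n y x ^ r) ^ t := by
  rw [Fintype.prod_sum (fun n y => (∑ x, Q x * P n y x ^ r) ^ t)]
  refine Finset.sum_congr rfl fun y _ => ?_
  rw [Real.finsetProd_rpow _ _ fun n _ => Finset.sum_nonneg fun x _ =>
    mul_nonneg (hQ0 x) (Real.rpow_nonneg (hP0 _ _ _) _)]
  rw [Fintype.prod_sum (fun n x => Q x * P n (y n) x ^ r)]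
  congr 1
  refine Finset.sum_congr rfl fun x _ => ?_
  rw [Finset.prod_mul_distrib, Real.finsetProd_rpow _ _ fun n _ => hP0 _ _ _]

theorem prod_comp_eq_of_card_fiber_eq {ι S : Type*} [Fintype ι] [Fintype S] (g : S → ℝ)
    (s t : ι → S)
    (h : ∀ σ, (Finset.univ.filter fun n => s n = σ).card
      = (Finset.univ.filter fun n => t n = σ).card) :
    ∏ n, g (s n) = ∏ n, g (t n) := by
  rw [← Finset.prod_fiberwise' Finset.univ s g, ← Finset.prod_fiberwise' Finset.univ t g]
  simp [Finset.prod_const, h]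

theorem sum_rpow_sum_pos {X Y : Type*} [Fintype X] [Fintype Y]
    (Q : X → ℝ) (hQ0 : ∀ x, 0 ≤ Q x) (hQ1 : ∑ x, Q x = 1)
    (P : Y → X → ℝ) (hP0 : ∀ y x, 0 ≤ P y x) (hP1 : ∀ x, ∑ y, P y x = 1) (r t : ℝ) :
    0 < ∑ y, (∑ x, Q x * P y x ^ r) ^ t := by
  have h_nonneg (y : Y) (x : X) : 0 ≤ Q x * P y x ^ r :=
    mul_nonneg (hQ0 x) (Real.rpow_nonneg (hP0 y x) _)
  obtain ⟨x, -, hx⟩ := Finset.exists_ne_zero_of_sum_ne_zero (by rw [hQ1]; exact one_ne_zero)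
  obtain ⟨y, -, hy⟩ := Finset.exists_ne_zero_of_sum_ne_zero (by rw [hP1 x]; exact one_ne_zero)
  refine Finset.sum_pos' (fun y _ => Real.rpow_nonneg (Finset.sum_nonneg fun x _ => h_nonneg y x) _)
    ⟨y, Finset.mem_univ y, Real.rpow_pos_of_pos ?_ _⟩
  exact Finset.sum_pos' (fun x _ => h_nonneg y x) ⟨x, Finset.mem_univ x,
    mul_pos ((hQ0 x).lt_of_ne' hx) (Real.rpow_pos_of_pos ((hP0 y x).lt_of_ne' hy) _)⟩

/-- Gallager-type bound on the conditional probability of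
maximum-likelihood decoding failure given that the random state sequence lies in a
set `u` of sequences all having the same empirical distribution.  The state sequence
`S` has distribution `μ`, independent of the codebook; given `S = s` and codeword
`C_0 = x`, the output is distributed as `∏ₙ P(yₙ|xₙ,sₙ)`.  For any `s* ∈ u`, the
conditional failure probability is at most `exp(−N(E_{0,N}(ρ,Q,s*) − ρR))`. -/
theorem stmt_1 {X Y S : Type*} [Fintype X] [Fintype Y] [Fintype S]
    (N M : ℕ) (hN : 1 ≤ N) (hM : 2 ≤ M)
    (Q : X → ℝ) (hQ0 : ∀ x, 0 ≤ Q x) (hQ1 : ∑ x, Q x = 1)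
    (P : Y → X → S → ℝ) (hP0 : ∀ y x s, 0 ≤ P y x s)
    (hP1 : ∀ x s, ∑ y, P y x s = 1)
    (μ : (Fin N → S) → ℝ) (hμ0 : ∀ sq, 0 ≤ μ sq) (hμ1 : ∑ sq, μ sq = 1)
    (u : Finset (Fin N → S))
    (hu : ∀ σ : S, ∀ s1 ∈ u, ∀ s2 ∈ u,
      (Finset.univ.filter fun n => s1 n = σ).card
        = (Finset.univ.filter fun n => s2 n = σ).card)
    (hupos : 0 < ∑ sq ∈ u, μ sq)
    (sstar : Fin N → S) (hstar : sstar ∈ u)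
    (ρ R : ℝ) (hρ0 : 0 ≤ ρ) (hρ1 : ρ ≤ 1)
    (hMR : (M : ℝ) - 1 ≤ Real.exp (N * R)) :
    (∑ sq ∈ u, μ sq *
        ∑ cb : Fin M → Fin N → X, ∑ y : Fin N → Y,
          (∏ i, ∏ n, Q (cb i n)) * (∏ n, P (y n) (cb ⟨0, by omega⟩ n) (sq n)) *
            (if ∃ i : Fin M, i ≠ ⟨0, by omega⟩ ∧
                (∏ n, P (y n) (cb ⟨0, by omega⟩ n) (sq n)) ≤ ∏ n, P (y n) (cb i n) (sq n)
              then 1 else 0)) / (∑ sq ∈ u, μ sq)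
      ≤ Real.exp (-(N : ℝ) *
          ((-(1 / (N : ℝ)) * Real.log (∏ n : Fin N, ∑ y : Y,
              (∑ x : X, Q x * P y x (sstar n) ^ (1 / (1 + ρ))) ^ (1 + ρ))) - ρ * R)) := by
  obtain ⟨m, rfl⟩ : ∃ m, M = m + 1 := ⟨M - 1, by omega⟩
  set g : S → ℝ := fun σ => ∑ y, (∑ x, Q x * P y x σ ^ (1 / (1 + ρ))) ^ (1 + ρ) with hg
  have hgpos (σ : S) : 0 < g σ :=
    sum_rpow_sum_pos Q hQ0 hQ1 (fun y x => P y x σ) (fun y x => hP0 y x σ) (fun x => hP1 x σ) _ _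
  have hprod : 0 < ∏ n, g (sstar n) := Finset.prod_pos fun n _ => hgpos _
  have hN' : (N : ℝ) ≠ 0 := Nat.cast_ne_zero.2 (by omega)
  have hexp : Real.exp (-(N : ℝ) *
      ((-(1 / (N : ℝ)) * Real.log (∏ n, g (sstar n))) - ρ * R))
      = Real.exp (N * R) ^ ρ * ∏ n, g (sstar n) := by
    rw [← Real.exp_mul]
    nth_rewrite 2 [← Real.exp_log hprod]
    rw [← Real.exp_add]
    congr 1
    field_simp
    ring
  rw [hexp, div_le_iff₀ hupos, Finset.mul_sum]
  refine Finset.sum_le_sum fun sq hsq => ?_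
  rw [mul_comm]
  refine mul_le_mul_of_nonneg_right ?_ (hμ0 sq)
  refine (random_coding_bound (fun x : Fin N → X => ∏ n, Q (x n))
    (fun x => Finset.prod_nonneg fun n _ => hQ0 _) (sum_pi_prod_eq_one Q hQ1 N)
    (fun (y : Fin N → Y) x => ∏ n, P (y n) (x n) (sq n))
    (fun y x => Finset.prod_nonneg fun n _ => hP0 _ _ _) m hρ0 hρ1).trans ?_
  rw [sum_rpow_sum_prod_eq_prod Q hQ0 (fun n y x => P y x (sq n)) (fun n y x => hP0 _ _ _),
    ← prod_comp_eq_of_card_fiber_eq g sq sstar fun σ => hu σ sq hsq sstar hstar]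
  refine mul_le_mul_of_nonneg_right ?_ (Finset.prod_nonneg fun n _ => (hgpos _).le)
  refine Real.rpow_le_rpow (Nat.cast_nonneg m) ?_ hρ0
  simpa using hMR
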